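/- arXiv:2601.22682 — 2 statements merged into one kernel-verified Lean document; each statement's English description precedes it below -/
import Mathlib

section
/- Let G : ℝ^{d_x} × ℝ^{d_y} → ℝ be L₂-smooth with L₂ > 0, and let γ ∈ (0, 1/(2L₂)). Then for any constants ρ_{v1} ≥ L₂ and ρ_{v2} ≥ 1/γ, the function (x,y) ↦ V_γ(x,y) + (ρ_{v1}/2)‖x‖² + (ρ_{v2}/2)‖y‖² is convex on ℝ^{d_x} × ℝ^{d_y}. -/
open scoped RealInnerProductSpace

noncomputable section

/-- `Euc d` is the Euclidean space `ℝ^d`. -/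
abbrev Euc (d : ℕ) : Type := EuclideanSpace ℝ (Fin d)

/-- Gradient of `h` with respect to the first block of variables. -/
noncomputable def gradx {dx dy : ℕ} (h : Euc dx → Euc dy → ℝ) (x : Euc dx) (y : Euc dy) :
    Euc dx :=
  gradient (fun x' => h x' y) x

/-- Gradient of `h` with respect to the second block of variables. -/
noncomputable def grady {dx dy : ℕ} (h : Euc dx → Euc dy → ℝ) (x : Euc dx) (y : Euc dy) :
    Euc dy :=
  gradient (fun y' => h x y') y

/-- The ℓ²-norm of a pair of vectors (the norm on the product `ℝ^{d_x} × ℝ^{d_y}`). -/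
noncomputable def pnorm {dx dy : ℕ} (a : Euc dx) (b : Euc dy) : ℝ :=
  Real.sqrt (‖a‖ ^ 2 + ‖b‖ ^ 2)

/-- `h : ℝ^{d_x} × ℝ^{d_y} → ℝ` is `L`-smooth: it is differentiable and its gradient is
`L`-Lipschitz with respect to the ℓ² product norm. -/
def LSmooth {dx dy : ℕ} (L : ℝ) (h : Euc dx → Euc dy → ℝ) : Prop :=
  (∀ y, Differentiable ℝ fun x => h x y) ∧ (∀ x, Differentiable ℝ fun y => h x y) ∧
    ∀ x y x' y',
      pnorm (gradx h x y - gradx h x' y') (grady h x y - grady h x' y') ≤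
        L * pnorm (x - x') (y - y')

/-- The Moreau envelope `V_γ` of `G`. -/
noncomputable def moreau {dx dy : ℕ} (G : Euc dx → Euc dy → ℝ) (γ : ℝ)
    (x : Euc dx) (y : Euc dy) : ℝ :=
  ⨅ θ : Euc dy, (G x θ + ‖θ - y‖ ^ 2 / (2 * γ))

lemma pnorm_nonneg {dx dy : ℕ} (a : Euc dx) (b : Euc dy) : 0 ≤ pnorm a b :=
  Real.sqrt_nonneg _

lemma pnorm_sq {dx dy : ℕ} (a : Euc dx) (b : Euc dy) : pnorm a b ^ 2 = ‖a‖ ^ 2 + ‖b‖ ^ 2 :=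
  Real.sq_sqrt (by positivity)

lemma pnorm_eq_norm {dx dy : ℕ} (a : Euc dx) (b : Euc dy) :
    pnorm a b = ‖WithLp.toLp 2 (a, b)‖ := by
  simp [WithLp.prod_norm_eq_of_L2, pnorm]

lemma pnorm_smul {dx dy : ℕ} (t : ℝ) (a : Euc dx) (b : Euc dy) :
    pnorm (t • a) (t • b) = |t| * pnorm a b := by
  simp only [pnorm_eq_norm]
  rw [← Prod.smul_mk, WithLp.toLp_smul, norm_smul, Real.norm_eq_abs]

/-- Cauchy–Schwarz inequality for pairs of vectors. -/
lemma abs_inner_add_inner_le_pnorm {dx dy : ℕ} (a u : Euc dx) (b v : Euc dy) :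
    |⟪a, u⟫ + ⟪b, v⟫| ≤ pnorm a b * pnorm u v := by
  simpa [pnorm_eq_norm, WithLp.prod_inner_apply] using
    abs_real_inner_le_norm (WithLp.toLp 2 (a, b)) (WithLp.toLp 2 (u, v))

lemma norm_fst_le_pnorm {dx dy : ℕ} (a : Euc dx) (b : Euc dy) : ‖a‖ ≤ pnorm a b :=
  Real.le_sqrt_of_sq_le (by nlinarith [sq_nonneg ‖b‖])

lemma norm_snd_le_pnorm {dx dy : ℕ} (a : Euc dx) (b : Euc dy) : ‖b‖ ≤ pnorm a b :=
  Real.le_sqrt_of_sq_le (by nlinarith [sq_nonneg ‖a‖])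

namespace LSmooth

variable {dx dy : ℕ} {L : ℝ} {G : Euc dx → Euc dy → ℝ}

lemma tendsto_pnorm (L : ℝ) (p : Euc dx × Euc dy) :
    Filter.Tendsto (fun q : Euc dx × Euc dy => L * pnorm (q.1 - p.1) (q.2 - p.2))
      (nhds p) (nhds 0) := by
  have hc : Continuous fun q : Euc dx × Euc dy => L * pnorm (q.1 - p.1) (q.2 - p.2) := by
    unfold pnorm
    fun_prop
  simpa [pnorm] using hc.tendsto p

lemma continuous_gradx (hG : LSmooth L G) :
    Continuous fun p : Euc dx × Euc dy => gradx G p.1 p.2 :=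
  continuous_iff_continuousAt.2 fun p => tendsto_iff_norm_sub_tendsto_zero.2 <|
    squeeze_zero (fun _ => norm_nonneg _)
      (fun q => (norm_fst_le_pnorm _ _).trans (hG.2.2 q.1 q.2 p.1 p.2)) (tendsto_pnorm L p)

lemma continuous_grady (hG : LSmooth L G) :
    Continuous fun p : Euc dx × Euc dy => grady G p.1 p.2 :=
  continuous_iff_continuousAt.2 fun p => tendsto_iff_norm_sub_tendsto_zero.2 <|
    squeeze_zero (fun _ => norm_nonneg _)
      (fun q => (norm_snd_le_pnorm _ _).trans (hG.2.2 q.1 q.2 p.1 p.2)) (tendsto_pnorm L p)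

lemma hasFDerivAt (hG : LSmooth L G) (p : Euc dx × Euc dy) :
    HasFDerivAt (fun q : Euc dx × Euc dy => G q.1 q.2)
      ((innerSL ℝ (gradx G p.1 p.2)).coprod (innerSL ℝ (grady G p.1 p.2))) p :=
  (hasStrictFDerivAt_uncurry_coprod (f := G)
    (f₁ := fun x y => innerSL ℝ (gradx G x y)) (f₂ := fun x y => innerSL ℝ (grady G x y))
    (.of_forall fun v => (hG.1 v.2 v.1).hasGradientAt.hasFDerivAt)
    (.of_forall fun v => (hG.2.1 v.1 v.2).hasGradientAt.hasFDerivAt)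
    ((innerSL ℝ).continuous.comp hG.continuous_gradx).continuousAt
    ((innerSL ℝ).continuous.comp hG.continuous_grady).continuousAt).hasFDerivAt

/-- Quadratic lower bound for an `L`-smooth function. -/
lemma quadratic_lower_bound (hG : LSmooth L G) (x u : Euc dx) (y v : Euc dy) :
    G x y + (⟪gradx G x y, u⟫ + ⟪grady G x y, v⟫) - L / 2 * (‖u‖ ^ 2 + ‖v‖ ^ 2) ≤
      G (x + u) (y + v) := by
  set c := ⟪gradx G x y, u⟫ + ⟪grady G x y, v⟫ with hc
  have hline (t : ℝ) :
      HasDerivAt (fun s : ℝ => ((x + s • u, y + s • v) : Euc dx × Euc dy)) (u, v) t := by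
    have hu := ((hasDerivAt_id t).smul_const u).const_add x
    have hv := ((hasDerivAt_id t).smul_const v).const_add y
    simpa using hu.prodMk hv
  have hderiv (t : ℝ) : HasDerivAt
      (fun s : ℝ => G (x + s • u) (y + s • v) - s * c + s ^ 2 * (L / 2 * (‖u‖ ^ 2 + ‖v‖ ^ 2)))
      (⟪gradx G (x + t • u) (y + t • v), u⟫ + ⟪grady G (x + t • u) (y + t • v), v⟫ - c
        + 2 * t * (L / 2 * (‖u‖ ^ 2 + ‖v‖ ^ 2))) t := by
    have h := (hG.hasFDerivAt (x + t • u, y + t • v)).comp_hasDerivAt t (hline t)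
    have h1 := (hasDerivAt_id t).mul_const c
    have h2 := (hasDerivAt_pow 2 t).mul_const (L / 2 * (‖u‖ ^ 2 + ‖v‖ ^ 2))
    simpa [Function.comp_def] using (h.fun_sub h1).fun_add h2
  have hmono := monotoneOn_of_hasDerivWithinAt_nonneg (convex_Icc (0 : ℝ) 1)
    (fun t _ => (hderiv t).continuousAt.continuousWithinAt)
    (fun t _ => (hderiv t).hasDerivWithinAt) (fun t ht => by
      rw [interior_Icc] at ht
      have hcs := abs_inner_add_inner_le_pnorm
        (gradx G (x + t • u) (y + t • v) - gradx G x y) u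
        (grady G (x + t • u) (y + t • v) - grady G x y) v
      have hlip := hG.2.2 (x + t • u) (y + t • v) x y
      rw [add_sub_cancel_left, add_sub_cancel_left, pnorm_smul, abs_of_pos ht.1] at hlip
      have hle := neg_le_of_abs_le hcs
      have hmul := mul_le_mul_of_nonneg_right hlip (pnorm_nonneg u v)
      rw [inner_sub_left, inner_sub_left] at hle
      have hsq := pnorm_sq u v
      rw [← hsq]
      linarith)
  have h01 := hmono (Set.left_mem_Icc.2 zero_le_one) (Set.right_mem_Icc.2 zero_le_one) zero_le_one
  simp only [zero_smul, one_smul, add_zero] at h01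
  linarith

/-- An `L`-smooth function is `L`-weakly convex. -/
lemma weakly_convex (hG : LSmooth L G) {a b : ℝ} (ha : 0 ≤ a) (hb : 0 ≤ b) (hab : a + b = 1)
    (x₁ x₂ : Euc dx) (y₁ y₂ : Euc dy) :
    G (a • x₁ + b • x₂) (a • y₁ + b • y₂) ≤ a * G x₁ y₁ + b * G x₂ y₂
      + L / 2 * (a * b) * (‖x₁ - x₂‖ ^ 2 + ‖y₁ - y₂‖ ^ 2) := by
  have h1 := hG.quadratic_lower_bound (a • x₁ + b • x₂) (b • (x₁ - x₂))
    (a • y₁ + b • y₂) (b • (y₁ - y₂))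
  have h2 := hG.quadratic_lower_bound (a • x₁ + b • x₂) ((-a) • (x₁ - x₂))
    (a • y₁ + b • y₂) ((-a) • (y₁ - y₂))
  obtain rfl : b = 1 - a := by linarith
  have e1 {d : ℕ} (p q : Euc d) : a • p + (1 - a) • q + (1 - a) • (p - q) = p := by module
  have e2 {d : ℕ} (p q : Euc d) : a • p + (1 - a) • q + (-a) • (p - q) = q := by module
  rw [e1, e1] at h1
  rw [e2, e2] at h2
  simp only [inner_smul_right, norm_smul, mul_pow, Real.norm_eq_abs, sq_abs] at h1 h2
  nlinarith [mul_le_mul_of_nonneg_left h1 ha, mul_le_mul_of_nonneg_left h2 hb]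

lemma bddBelow_moreau (hG : LSmooth L G) (hL : 0 < L) {γ : ℝ}
    (hγ : L ≤ 1 / (2 * γ)) (x : Euc dx) (y : Euc dy) :
    BddBelow (Set.range fun θ : Euc dy => G x θ + ‖θ - y‖ ^ 2 / (2 * γ)) := by
  refine ⟨G x y - ‖grady G x y‖ ^ 2 / (2 * L), ?_⟩
  rintro _ ⟨θ, rfl⟩
  have h := hG.quadratic_lower_bound x 0 y (θ - y)
  simp only [add_zero, inner_zero_right, zero_add, norm_zero, add_sub_cancel] at h
  have hcs := neg_le_of_abs_le (abs_real_inner_le_norm (grady G x y) (θ - y))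
  have hq : L * ‖θ - y‖ ^ 2 ≤ ‖θ - y‖ ^ 2 / (2 * γ) := by
    rw [div_eq_inv_mul, ← one_div]
    gcongr
  have hs : 0 ≤ (L * ‖θ - y‖ - ‖grady G x y‖) ^ 2 / (2 * L) := by positivity
  have he : (L * ‖θ - y‖ - ‖grady G x y‖) ^ 2 / (2 * L) = L / 2 * ‖θ - y‖ ^ 2
      - ‖grady G x y‖ * ‖θ - y‖ + ‖grady G x y‖ ^ 2 / (2 * L) := by
    field_simp
    ring
  dsimp only
  linarith

end LSmooth

/-- The squared norm of a convex combination. -/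
lemma norm_sq_convex_comb {E : Type*} [NormedAddCommGroup E] [InnerProductSpace ℝ E]
    {a b : ℝ} (hab : a + b = 1) (u v : E) :
    ‖a • u + b • v‖ ^ 2 = a * ‖u‖ ^ 2 + b * ‖v‖ ^ 2 - a * b * ‖u - v‖ ^ 2 := by
  obtain rfl : b = 1 - a := by linarith
  rw [norm_add_sq_real, norm_sub_sq_real]
  simp only [inner_smul_left, inner_smul_right, norm_smul, mul_pow, Real.norm_eq_abs, sq_abs]
  simp
  ring

/-- The function of `(x, θ, y)` minimized over `θ` in the Moreau envelope is jointly convex once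
the quadratic terms are added. -/
lemma LSmooth.moreau_objective_convex {dx dy : ℕ} {L γ ρ₁ ρ₂ : ℝ} {G : Euc dx → Euc dy → ℝ}
    (hG : LSmooth L G) (hL : 0 < L) (hγ : L ≤ 1 / (2 * γ)) (hρ₁ : L ≤ ρ₁) (hρ₂ : 1 / γ ≤ ρ₂)
    {a b : ℝ} (ha : 0 ≤ a) (hb : 0 ≤ b) (hab : a + b = 1)
    (x₁ x₂ : Euc dx) (θ₁ θ₂ y₁ y₂ : Euc dy) :
    G (a • x₁ + b • x₂) (a • θ₁ + b • θ₂)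
        + ‖a • θ₁ + b • θ₂ - (a • y₁ + b • y₂)‖ ^ 2 / (2 * γ)
        + ρ₁ / 2 * ‖a • x₁ + b • x₂‖ ^ 2 + ρ₂ / 2 * ‖a • y₁ + b • y₂‖ ^ 2 ≤
      a * (G x₁ θ₁ + ‖θ₁ - y₁‖ ^ 2 / (2 * γ) + ρ₁ / 2 * ‖x₁‖ ^ 2 + ρ₂ / 2 * ‖y₁‖ ^ 2)
      + b * (G x₂ θ₂ + ‖θ₂ - y₂‖ ^ 2 / (2 * γ) + ρ₁ / 2 * ‖x₂‖ ^ 2 + ρ₂ / 2 * ‖y₂‖ ^ 2) := by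
  have hw := hG.weakly_convex ha hb hab x₁ x₂ θ₁ θ₂
  have e : a • θ₁ + b • θ₂ - (a • y₁ + b • y₂) = a • (θ₁ - y₁) + b • (θ₂ - y₂) := by module
  rw [e, norm_sq_convex_comb hab, norm_sq_convex_comb hab x₁, norm_sq_convex_comb hab y₁]
  have hρ₂' : 2 * (1 / (2 * γ)) ≤ ρ₂ := by
    convert hρ₂ using 1
    ring
  rw [one_div] at hγ hρ₂'
  simp only [div_eq_mul_inv _ (2 * γ)]
  generalize (2 * γ)⁻¹ = κ at *
  have hθ : ‖θ₁ - θ₂‖ ^ 2 ≤ 2 * ‖θ₁ - y₁ - (θ₂ - y₂)‖ ^ 2 + 2 * ‖y₁ - y₂‖ ^ 2 := by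
    have et : θ₁ - θ₂ = (θ₁ - y₁ - (θ₂ - y₂)) + (y₁ - y₂) := by abel
    have hn := norm_add_le (θ₁ - y₁ - (θ₂ - y₂)) (y₁ - y₂)
    rw [← et] at hn
    nlinarith [norm_nonneg (θ₁ - θ₂), sq_nonneg (‖θ₁ - y₁ - (θ₂ - y₂)‖ - ‖y₁ - y₂‖)]
  have hquad : L / 2 * (‖x₁ - x₂‖ ^ 2 + ‖θ₁ - θ₂‖ ^ 2) ≤ ρ₁ / 2 * ‖x₁ - x₂‖ ^ 2
      + κ * ‖θ₁ - y₁ - (θ₂ - y₂)‖ ^ 2 + ρ₂ / 2 * ‖y₁ - y₂‖ ^ 2 := by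
    have h1 := mul_le_mul_of_nonneg_left hθ (half_pos hL).le
    have h2 := mul_le_mul_of_nonneg_right hρ₁ (sq_nonneg ‖x₁ - x₂‖)
    have h3 := mul_le_mul_of_nonneg_right hγ (sq_nonneg ‖θ₁ - y₁ - (θ₂ - y₂)‖)
    have h4 := mul_le_mul_of_nonneg_right (show 2 * L ≤ ρ₂ by linarith) (sq_nonneg ‖y₁ - y₂‖)
    linarith
  have := mul_le_mul_of_nonneg_left hquad (mul_nonneg ha hb)
  linarith

/-- for an `L₂`-smooth `G` and `γ ∈ (0, 1/(2L₂))`, for any `ρ_{v1} ≥ L₂` and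
`ρ_{v2} ≥ 1/γ`, the function `(x,y) ↦ V_γ(x,y) + (ρ_{v1}/2)‖x‖² + (ρ_{v2}/2)‖y‖²` is convex. -/
theorem moreau_plus_quadratic_convex {dx dy : ℕ} (L₂ γ ρv1 ρv2 : ℝ) (hL₂ : 0 < L₂)
    (G : Euc dx → Euc dy → ℝ) (hG : LSmooth L₂ G)
    (hγ0 : 0 < γ) (hγ : γ < 1 / (2 * L₂))
    (hρ1 : L₂ ≤ ρv1) (hρ2 : 1 / γ ≤ ρv2) :
    ConvexOn ℝ Set.univ
      (fun p : Euc dx × Euc dy =>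
        moreau G γ p.1 p.2 + ρv1 / 2 * ‖p.1‖ ^ 2 + ρv2 / 2 * ‖p.2‖ ^ 2) := by
  have hκ : L₂ ≤ 1 / (2 * γ) := by
    rw [lt_div_iff₀ (by positivity)] at hγ
    rw [le_div_iff₀ (by positivity)]
    linarith
  refine ⟨convex_univ, ?_⟩
  rintro ⟨x₁, y₁⟩ - ⟨x₂, y₂⟩ - a b ha hb hab
  simp only [Prod.smul_mk, Prod.mk_add_mk, smul_eq_mul]
  refine le_of_forall_pos_le_add fun ε hε => ?_
  obtain ⟨θ₁, hθ₁⟩ := exists_lt_of_ciInf_lt (lt_add_of_pos_right (moreau G γ x₁ y₁) hε)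
  obtain ⟨θ₂, hθ₂⟩ := exists_lt_of_ciInf_lt (lt_add_of_pos_right (moreau G γ x₂ y₂) hε)
  have hle : moreau G γ (a • x₁ + b • x₂) (a • y₁ + b • y₂) ≤ _ :=
    ciInf_le (hG.bddBelow_moreau hL₂ hκ _ _) (a • θ₁ + b • θ₂)
  have hconv := hG.moreau_objective_convex hL₂ hκ hρ1 hρ2 ha hb hab x₁ x₂ θ₁ θ₂ y₁ y₂
  have h1 := mul_le_mul_of_nonneg_left hθ₁.le ha
  have h2 := mul_le_mul_of_nonneg_left hθ₂.le hb
  have hεab : a * ε + b * ε = ε := by rw [← add_mul, hab, one_mul]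
  linarith
end
end

section
/- Let f_i : ℝ^{d_x} × ℝ^{d_y} → ℝ (i = 1,…,n) be L₁-smooth with F := (1/n)∑f_i bounded below by F̲, let g_i be L₂-smooth with L₂ > 0 and G := (1/n)∑g_i, let γ ∈ (0, 1/(2L₂)), μ ≥ 0, and set L_Φ := μL₁ + L₂ + max{L₂, 1/γ} and Φ_μ(x,y) := μ(F(x,y) − F̲) + G(x,y) − V_γ(x,y). Let (x_i)_{i=1}^n, (y_i)_{i=1}^n, (θ_i)_{i=1}^n be families of vectors with averages x̄, ȳ, θ̄, and define the exact averaged descent directions D̄_x := (1/n)∑_i ( μ∇_x f_i(x_i,y_i) + ∇_x g_i(x_i,y_i) − ∇_x g_i(x_i,θ_i) ) and D̄_y := (1/n)∑_i ( μ∇_y f_i(x_i,y_i) + ∇_y g_i(x_i,y_i) − (y_i − θ_i)/γ ). Then for any step sizes λ_x, λ_y > 0, with x̄⁺ := x̄ − λ_x D̄_x and ȳ⁺ := ȳ − λ_y D̄_y: Φ_μ(x̄⁺,ȳ⁺) − Φ_μ(x̄,ȳ) ≤ −(1/(2λ_x) − L_Φ/2)‖x̄⁺ − x̄‖² − (1/(2λ_y)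 − L_Φ/2)‖ȳ⁺ − ȳ‖² + (λ_x L₂² + λ_y/γ²)‖θ̄ − θ*_γ(x̄,ȳ)‖² + ( 3λ_x(μ²L₁² + 2L₂²) + 4λ_y(μ²L₁² + L₂²) ) Δ_x + ( 3λ_x(μ²L₁² + L₂²) + 4λ_y(μ²L₁² + L₂² + 1/γ²) ) Δ_y + ( 3λ_x L₂² + 4λ_y/γ² ) Δ_θ. -/
open scoped RealInnerProductSpace

noncomputable section

/-- The average `(1/n) ∑ᵢ vᵢ` of a family of vectors. -/
noncomputable def avg {n : ℕ} {V : Type} [AddCommGroup V] [Module ℝ V] (v : Fin n → V) : V :=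
  (n : ℝ)⁻¹ • ∑ i, v i

/-- The mean squared deviation `(1/n) ∑ᵢ ‖vᵢ − v̄‖²` of a family of vectors. -/
noncomputable def devSq {n d : ℕ} (v : Fin n → Euc d) : ℝ :=
  (n : ℝ)⁻¹ * ∑ i, ‖v i - avg v‖ ^ 2

namespace PenalizedDescent

variable {dx dy : ℕ}

lemma abs_inner_add_inner_le (a u : Euc dx) (b v : Euc dy) :
    |⟪a, u⟫ + ⟪b, v⟫| ≤ pnorm a b * pnorm u v := by
  have h1 : |⟪a, u⟫ + ⟪b, v⟫| ≤ ‖a‖ * ‖u‖ + ‖b‖ * ‖v‖ := by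
    refine (abs_add_le _ _).trans ?_
    gcongr <;> exact abs_real_inner_le_norm _ _
  refine h1.trans ?_
  unfold pnorm
  rw [← Real.sqrt_mul (by positivity)]
  apply Real.le_sqrt_of_sq_le
  nlinarith [sq_nonneg (‖a‖ * ‖v‖ - ‖b‖ * ‖u‖)]

lemma pnorm_sq (a : Euc dx) (b : Euc dy) : pnorm a b ^ 2 = ‖a‖ ^ 2 + ‖b‖ ^ 2 :=
  Real.sq_sqrt (by positivity)

lemma pnorm_nonneg (a : Euc dx) (b : Euc dy) : 0 ≤ pnorm a b := Real.sqrt_nonneg _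

lemma norm_sq_add_norm_sq_le {L : ℝ} {h : Euc dx → Euc dy → ℝ} (hh : LSmooth L h)
    (x x' : Euc dx) (y y' : Euc dy) :
    ‖gradx h x y - gradx h x' y'‖ ^ 2 + ‖grady h x y - grady h x' y'‖ ^ 2 ≤
      L ^ 2 * (‖x - x'‖ ^ 2 + ‖y - y'‖ ^ 2) := by
  rw [← pnorm_sq, ← pnorm_sq, ← mul_pow]
  exact pow_le_pow_left₀ (pnorm_nonneg _ _) (hh.2.2 x y x' y') 2

lemma norm_gradx_sub_sq_le {L : ℝ} {h : Euc dx → Euc dy → ℝ} (hh : LSmooth L h)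
    (x x' : Euc dx) (y y' : Euc dy) :
    ‖gradx h x y - gradx h x' y'‖ ^ 2 ≤ L ^ 2 * (‖x - x'‖ ^ 2 + ‖y - y'‖ ^ 2) :=
  (le_add_of_nonneg_right (sq_nonneg _)).trans (norm_sq_add_norm_sq_le hh x x' y y')

lemma norm_grady_sub_sq_le {L : ℝ} {h : Euc dx → Euc dy → ℝ} (hh : LSmooth L h)
    (x x' : Euc dx) (y y' : Euc dy) :
    ‖grady h x y - grady h x' y'‖ ^ 2 ≤ L ^ 2 * (‖x - x'‖ ^ 2 + ‖y - y'‖ ^ 2) :=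
  (le_add_of_nonneg_left (sq_nonneg _)).trans (norm_sq_add_norm_sq_le hh x x' y y')

lemma continuous_of_norm_sub_sq_le {d : ℕ} {C : ℝ} {k : Euc dx × Euc dy → Euc d}
    (hk : ∀ p q, ‖k p - k q‖ ^ 2 ≤ C ^ 2 * (‖p.1 - q.1‖ ^ 2 + ‖p.2 - q.2‖ ^ 2)) :
    Continuous k := by
  rw [continuous_iff_continuousAt]
  intro q
  rw [ContinuousAt, tendsto_iff_norm_sub_tendsto_zero]
  have hlim : Filter.Tendsto
      (fun p : Euc dx × Euc dy => Real.sqrt (C ^ 2 * (‖p.1 - q.1‖ ^ 2 + ‖p.2 - q.2‖ ^ 2)))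
      (nhds q) (nhds 0) := by
    have hc : Continuous (fun p : Euc dx × Euc dy =>
        Real.sqrt (C ^ 2 * (‖p.1 - q.1‖ ^ 2 + ‖p.2 - q.2‖ ^ 2))) := by fun_prop
    simpa using hc.tendsto q
  exact squeeze_zero (fun _ => norm_nonneg _) (fun p => Real.le_sqrt_of_sq_le (hk p q)) hlim

lemma hasFDerivAt_of_lsmooth {L : ℝ} {h : Euc dx → Euc dy → ℝ} (hh : LSmooth L h)
    (p : Euc dx × Euc dy) :
    HasFDerivAt (fun q : Euc dx × Euc dy => h q.1 q.2)
      ((innerSL ℝ (gradx h p.1 p.2)).coprod (innerSL ℝ (grady h p.1 p.2))) p := by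
  have hcx : Continuous (fun q : Euc dx × Euc dy => gradx h q.1 q.2) :=
    continuous_of_norm_sub_sq_le (C := L)
      fun p q => norm_gradx_sub_sq_le hh p.1 q.1 p.2 q.2
  have hcy : Continuous (fun q : Euc dx × Euc dy => grady h q.1 q.2) :=
    continuous_of_norm_sub_sq_le (C := L)
      fun p q => norm_grady_sub_sq_le hh p.1 q.1 p.2 q.2
  exact (hasStrictFDerivAt_uncurry_coprod (u := p) (f := h)
    (f₁ := fun x y => innerSL ℝ (gradx h x y)) (f₂ := fun x y => innerSL ℝ (grady h x y))
    (.of_forall fun v => (hh.1 v.2 v.1).hasGradientAt.hasFDerivAt)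
    (.of_forall fun v => (hh.2.1 v.1 v.2).hasGradientAt.hasFDerivAt)
    ((innerSL ℝ).continuous.comp hcx).continuousAt
    ((innerSL ℝ).continuous.comp hcy).continuousAt).hasFDerivAt

/-- Quadratic bounds on the first-order Taylor remainder of a smooth function. -/
lemma abs_taylor_remainder_le {L : ℝ} {h : Euc dx → Euc dy → ℝ} (hh : LSmooth L h)
    (x x' : Euc dx) (y y' : Euc dy) :
    |h x' y' - h x y - (⟪gradx h x y, x' - x⟫ + ⟪grady h x y, y' - y⟫)| ≤
      L / 2 * (‖x' - x‖ ^ 2 + ‖y' - y‖ ^ 2) := by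
  set u := x' - x with hu
  set v := y' - y with hv
  set N := ‖u‖ ^ 2 + ‖v‖ ^ 2 with hN
  set s := ⟪gradx h x y, u⟫ + ⟪grady h x y, v⟫ with hs
  let r : ℝ → ℝ := fun t => ⟪gradx h (x + t • u) (y + t • v), u⟫ +
    ⟪grady h (x + t • u) (y + t • v), v⟫
  have hder (t : ℝ) : HasDerivAt (fun t : ℝ => h (x + t • u) (y + t • v)) (r t) t := by
    have hl : HasDerivAt (fun t : ℝ => (x + t • u, y + t • v)) (u, v) t := by
      have h1 : HasDerivAt (fun t : ℝ => x + t • u) u t := by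
        simpa using ((hasDerivAt_id t).smul_const u).const_add x
      have h2 : HasDerivAt (fun t : ℝ => y + t • v) v t := by
        simpa using ((hasDerivAt_id t).smul_const v).const_add y
      exact h1.prodMk h2
    have := (hasFDerivAt_of_lsmooth hh (x + t • u, y + t • v)).comp_hasDerivAt t hl
    simpa [Function.comp_def, r] using this
  have hr (t : ℝ) (ht : 0 ≤ t) : |r t - s| ≤ L * t * N := by
    have e : r t - s = ⟪gradx h (x + t • u) (y + t • v) - gradx h x y, u⟫ +
        ⟪grady h (x + t • u) (y + t • v) - grady h x y, v⟫ := by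
      simp only [r, hs, inner_sub_left]; ring
    have hp : pnorm (x + t • u - x) (y + t • v - y) = t * pnorm u v := by
      simp only [add_sub_cancel_left]
      unfold pnorm
      rw [norm_smul, norm_smul, mul_pow, mul_pow, ← mul_add, Real.sqrt_mul (by positivity),
        Real.norm_eq_abs, sq_abs, Real.sqrt_sq ht]
    rw [e]
    refine (abs_inner_add_inner_le _ _ _ _).trans ?_
    have := mul_le_mul_of_nonneg_right (hh.2.2 (x + t • u) (y + t • v) x y) (pnorm_nonneg u v)
    rw [hp] at this
    refine this.trans (le_of_eq ?_)
    rw [hN, ← pnorm_sq]; ring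
  have hq (c t : ℝ) : HasDerivAt (fun t : ℝ => t * s + c * t ^ 2) (s + c * (2 * t)) t := by
    have h1 := (hasDerivAt_id t).mul_const s
    have h2 := ((hasDerivAt_id t).pow 2).const_mul c
    simpa [Pi.add_def] using h1.add h2
  have hx : x + u = x' := by simp [hu]
  have hy : y + v = y' := by simp [hv]
  have bound (c : ℝ) := fun t => (hder t).sub (hq c t)
  have up : AntitoneOn (fun t : ℝ => h (x + t • u) (y + t • v) - (t * s + L / 2 * N * t ^ 2))
      (Set.Ici 0) := by
    refine antitoneOn_of_deriv_nonpos (convex_Ici 0)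
      (fun t _ => (bound (L / 2 * N) t).continuousAt.continuousWithinAt)
      (fun t _ => (bound (L / 2 * N) t).differentiableAt.differentiableWithinAt) ?_
    intro t ht
    rw [interior_Ici] at ht
    have e := (bound (L / 2 * N) t).deriv
    have := (abs_le.1 (hr t ht.le)).2
    refine e.le.trans ?_
    linarith
  have lo : MonotoneOn (fun t : ℝ => h (x + t • u) (y + t • v) - (t * s + -(L / 2 * N) * t ^ 2))
      (Set.Ici 0) := by
    refine monotoneOn_of_deriv_nonneg (convex_Ici 0)
      (fun t _ => (bound (-(L / 2 * N)) t).continuousAt.continuousWithinAt)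
      (fun t _ => (bound (-(L / 2 * N)) t).differentiableAt.differentiableWithinAt) ?_
    intro t ht
    rw [interior_Ici] at ht
    have e := (bound (-(L / 2 * N)) t).deriv
    have := (abs_le.1 (hr t ht.le)).1
    refine le_trans ?_ e.ge
    linarith
  have h1 := up (Set.mem_Ici.2 le_rfl) (Set.mem_Ici.2 zero_le_one) zero_le_one
  have h2 := lo (Set.mem_Ici.2 le_rfl) (Set.mem_Ici.2 zero_le_one) zero_le_one
  simp only [one_smul, zero_smul, add_zero, hx, hy] at h1 h2
  rw [abs_le]
  constructor <;> linarith

/-- Jensen's inequality for the squared norm of an average. -/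
lemma norm_avg_sq_le {n d : ℕ} (v : Fin n → Euc d) :
    ‖(n : ℝ)⁻¹ • ∑ i, v i‖ ^ 2 ≤ (n : ℝ)⁻¹ * ∑ i, ‖v i‖ ^ 2 := by
  rcases Nat.eq_zero_or_pos n with rfl | hn
  · simp
  have hn' : (0 : ℝ) < n := by exact_mod_cast hn
  have h1 : ‖∑ i, v i‖ ^ 2 ≤ n * ∑ i, ‖v i‖ ^ 2 := by
    refine (pow_le_pow_left₀ (norm_nonneg _) (norm_sum_le _ _) 2).trans ?_
    simpa using sq_sum_le_card_mul_sum_sq (s := Finset.univ) (f := fun i => ‖v i‖)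
  rw [norm_smul, mul_pow, Real.norm_eq_abs, sq_abs]
  calc ((n : ℝ)⁻¹) ^ 2 * ‖∑ i, v i‖ ^ 2 ≤ ((n : ℝ)⁻¹) ^ 2 * (n * ∑ i, ‖v i‖ ^ 2) := by gcongr
    _ = _ := by field_simp

lemma norm_add_sq_le_two {d : ℕ} (a b : Euc d) : ‖a + b‖ ^ 2 ≤ 2 * (‖a‖ ^ 2 + ‖b‖ ^ 2) := by
  have h := pow_le_pow_left₀ (norm_nonneg _) (norm_add_le a b) 2
  nlinarith [sq_nonneg (‖a‖ - ‖b‖)]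

lemma norm_add_sq_le_three {d : ℕ} (a b c : Euc d) :
    ‖a + b + c‖ ^ 2 ≤ 3 * (‖a‖ ^ 2 + ‖b‖ ^ 2 + ‖c‖ ^ 2) := by
  have h := pow_le_pow_left₀ (norm_nonneg _) (norm_add₃_le (a := a) (b := b) (c := c)) 2
  nlinarith [sq_nonneg (‖a‖ - ‖b‖), sq_nonneg (‖b‖ - ‖c‖), sq_nonneg (‖a‖ - ‖c‖)]

/-- A gradient step with an inexact direction `D` in place of `p`. -/
lemma inner_step_le {d : ℕ} {lam : ℝ} (hlam : 0 < lam) (p D u : Euc d) (hu : u = -(lam • D)) :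
    ⟪p, u⟫ ≤ -(1 / (2 * lam)) * ‖u‖ ^ 2 + lam / 2 * ‖p - D‖ ^ 2 := by
  have h := norm_sub_sq_real p D
  have e1 : ⟪p, u⟫ = -(lam * ⟪p, D⟫) := by rw [hu, inner_neg_right, real_inner_smul_right]
  have e2 : 1 / (2 * lam) * ‖u‖ ^ 2 = lam / 2 * ‖D‖ ^ 2 := by
    rw [hu, norm_neg, norm_smul, mul_pow, Real.norm_eq_abs, sq_abs]; field_simp
  rw [e1, neg_mul, e2, h]
  nlinarith [mul_nonneg hlam.le (sq_nonneg ‖p‖)]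

/-- Infimum of the proximal objective at its strict minimizer. -/
lemma moreau_eq {G : Euc dx → Euc dy → ℝ} {γ : ℝ} {x : Euc dx} {y t : Euc dy}
    (ht : ∀ θ, θ ≠ t → G x t + ‖t - y‖ ^ 2 / (2 * γ) < G x θ + ‖θ - y‖ ^ 2 / (2 * γ)) :
    moreau G γ x y = G x t + ‖t - y‖ ^ 2 / (2 * γ) := by
  refine IsLeast.csInf_eq ⟨⟨t, rfl⟩, ?_⟩
  rintro _ ⟨θ, rfl⟩
  by_cases h : θ = t
  · rw [h]
  · exact (ht θ h).le

/-- First-order optimality condition of the proximal problem. -/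
lemma prox_optimality {n : ℕ} {g : Fin n → Euc dx → Euc dy → ℝ} {L γ : ℝ}
    (hg : ∀ i, LSmooth L (g i)) {x : Euc dx} {y t : Euc dy}
    (ht : ∀ θ, (n : ℝ)⁻¹ * ∑ i, g i x t + ‖t - y‖ ^ 2 / (2 * γ) ≤
      (n : ℝ)⁻¹ * ∑ i, g i x θ + ‖θ - y‖ ^ 2 / (2 * γ)) (w : Euc dy) :
    ⟪(n : ℝ)⁻¹ • ∑ i, grady (g i) x t, w⟫ = γ⁻¹ * ⟪y - t, w⟫ := by
  have h1 (i : Fin n) : HasFDerivAt (fun θ => g i x θ) (innerSL ℝ (grady (g i) x t)) t :=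
    ((hg i).2.1 x t).hasGradientAt.hasFDerivAt
  have h2 := (HasFDerivAt.fun_sum (u := Finset.univ) fun i _ => h1 i).const_mul ((n : ℝ)⁻¹)
  have h3 := (((hasFDerivAt_id t).sub_const y).norm_sq).mul_const ((2 * γ)⁻¹)
  have hmin : IsLocalMin (fun θ => (n : ℝ)⁻¹ * ∑ i, g i x θ + ‖θ - y‖ ^ 2 * (2 * γ)⁻¹) t :=
    Filter.Eventually.of_forall fun θ => by simpa only [div_eq_mul_inv] using ht θ
  have h4 := hmin.hasFDerivAt_eq_zero (h2.add h3)
  have h5 := DFunLike.congr_fun h4 w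
  simp only [mul_inv_rev, id_eq, map_sub, ContinuousLinearMap.comp_id, add_apply,
    smul_apply, sum_apply, innerSL_apply_apply, smul_eq_mul,
    sub_apply, zero_apply, nsmul_eq_mul, Nat.cast_ofNat] at h5
  rw [real_inner_smul_left, sum_inner, inner_sub_left]
  linear_combination h5

/-- Taylor remainder bound for the average of a family of smooth functions. -/
lemma abs_avg_taylor_remainder_le {n : ℕ} (hn : 0 < n) {L : ℝ} {h : Fin n → Euc dx → Euc dy → ℝ}
    (hh : ∀ i, LSmooth L (h i)) (x x' : Euc dx) (y y' : Euc dy) :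
    |(n : ℝ)⁻¹ * ∑ i, h i x' y' - (n : ℝ)⁻¹ * ∑ i, h i x y -
      (⟪(n : ℝ)⁻¹ • ∑ i, gradx (h i) x y, x' - x⟫ +
        ⟪(n : ℝ)⁻¹ • ∑ i, grady (h i) x y, y' - y⟫)| ≤
      L / 2 * (‖x' - x‖ ^ 2 + ‖y' - y‖ ^ 2) := by
  have hn' : (0 : ℝ) < n := by exact_mod_cast hn
  have e : (n : ℝ)⁻¹ * ∑ i, h i x' y' - (n : ℝ)⁻¹ * ∑ i, h i x y -
      (⟪(n : ℝ)⁻¹ • ∑ i, gradx (h i) x y, x' - x⟫ +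
        ⟪(n : ℝ)⁻¹ • ∑ i, grady (h i) x y, y' - y⟫) =
      (n : ℝ)⁻¹ * ∑ i, (h i x' y' - h i x y -
        (⟪gradx (h i) x y, x' - x⟫ + ⟪grady (h i) x y, y' - y⟫)) := by
    simp only [real_inner_smul_left, sum_inner, Finset.sum_sub_distrib, Finset.sum_add_distrib]
    ring
  rw [e, abs_mul, abs_of_pos (inv_pos.2 hn')]
  calc (n : ℝ)⁻¹ * |∑ i, (h i x' y' - h i x y -
        (⟪gradx (h i) x y, x' - x⟫ + ⟪grady (h i) x y, y' - y⟫))|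
      ≤ (n : ℝ)⁻¹ * ∑ _i : Fin n, L / 2 * (‖x' - x‖ ^ 2 + ‖y' - y‖ ^ 2) := by
        gcongr
        exact (Finset.abs_sum_le_sum_abs _ _).trans
          (Finset.sum_le_sum fun i _ => abs_taylor_remainder_le (hh i) x x' y y')
    _ = L / 2 * (‖x' - x‖ ^ 2 + ‖y' - y‖ ^ 2) := by
        simp only [Finset.sum_const, Finset.card_univ, Fintype.card_fin, nsmul_eq_mul]
        field_simp

/-- Weak convexity of the Moreau envelope: a quadratic lower bound with modulus `1 / γ`. -/
lemma prox_value_sub_ge {n : ℕ} (hn : 0 < n) {L γ : ℝ} (hL : 0 < L) (hγ0 : 0 < γ)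
    (hγ : γ < 1 / (2 * L)) {g : Fin n → Euc dx → Euc dy → ℝ} (hg : ∀ i, LSmooth L (g i))
    {x x' : Euc dx} {y y' t t' : Euc dy}
    (ht : ∀ θ, (n : ℝ)⁻¹ * ∑ i, g i x t + ‖t - y‖ ^ 2 / (2 * γ) ≤
      (n : ℝ)⁻¹ * ∑ i, g i x θ + ‖θ - y‖ ^ 2 / (2 * γ)) :
    ⟪(n : ℝ)⁻¹ • ∑ i, gradx (g i) x t, x' - x⟫ + γ⁻¹ * ⟪y - t, y' - y⟫ -
        max L (1 / γ) / 2 * (‖x' - x‖ ^ 2 + ‖y' - y‖ ^ 2) ≤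
      ((n : ℝ)⁻¹ * ∑ i, g i x' t' + ‖t' - y'‖ ^ 2 / (2 * γ)) -
        ((n : ℝ)⁻¹ * ∑ i, g i x t + ‖t - y‖ ^ 2 / (2 * γ)) := by
  have h1 := (abs_le.1 (abs_avg_taylor_remainder_le hn hg x x' t t')).1
  rw [prox_optimality hg ht] at h1
  have hsq : ‖t' - y'‖ ^ 2 = ‖t - y‖ ^ 2 + 2 * ⟪t - y, (t' - t) - (y' - y)⟫ +
      ‖(t' - t) - (y' - y)‖ ^ 2 := by
    rw [← norm_add_sq_real]; congr 2; abel
  have hin : ⟪t - y, (t' - t) - (y' - y)⟫ = -⟪y - t, t' - t⟫ + ⟪y - t, y' - y⟫ := by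
    rw [inner_sub_right, ← neg_sub y t, inner_neg_left, inner_neg_left]; ring
  have hdt : ‖t' - t‖ ^ 2 ≤ 2 * (‖(t' - t) - (y' - y)‖ ^ 2 + ‖y' - y‖ ^ 2) := by
    simpa using norm_add_sq_le_two ((t' - t) - (y' - y)) (y' - y)
  have hLγ : 2 * L ≤ γ⁻¹ := by
    rw [lt_div_iff₀ (by positivity)] at hγ
    rw [← one_div, le_div_iff₀ hγ0]; linarith
  have hm1 : L ≤ max L (1 / γ) := le_max_left _ _
  have hm2 : γ⁻¹ ≤ max L (1 / γ) := by rw [← one_div]; exact le_max_right _ _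
  have e (a : ℝ) : a / (2 * γ) = γ⁻¹ / 2 * a := by field_simp
  rw [hsq, hin, e, e]
  have k1 := mul_le_mul_of_nonneg_left hdt hL.le
  have k2 := mul_le_mul_of_nonneg_right hLγ
    (show 0 ≤ ‖(t' - t) - (y' - y)‖ ^ 2 + ‖y' - y‖ ^ 2 by positivity)
  have k3 := mul_le_mul_of_nonneg_right hm1 (sq_nonneg ‖x' - x‖)
  have k4 := mul_le_mul_of_nonneg_right hm2 (sq_nonneg ‖y' - y‖)
  linarith

/-- Error of the averaged inexact direction in the first block. -/
lemma norm_direction_x_sub_sq_le {L₁ L₂ μ : ℝ} {f g : Euc dx → Euc dy → ℝ}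
    (hf : LSmooth L₁ f) (hg : LSmooth L₂ g) (a x : Euc dx) (b y c t s : Euc dy) :
    ‖(μ • gradx f a b + gradx g a b - gradx g a s) -
        (μ • gradx f x y + gradx g x y - gradx g x t)‖ ^ 2 ≤
      6 * (μ ^ 2 * L₁ ^ 2 + 2 * L₂ ^ 2) * ‖x - a‖ ^ 2 +
        6 * (μ ^ 2 * L₁ ^ 2 + L₂ ^ 2) * ‖y - b‖ ^ 2 + 6 * L₂ ^ 2 * ‖t - c‖ ^ 2 +
        2 * L₂ ^ 2 * ‖c - s‖ ^ 2 := by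
  have e : (μ • gradx f a b + gradx g a b - gradx g a s) -
        (μ • gradx f x y + gradx g x y - gradx g x t) =
      (μ • (gradx f a b - gradx f x y) + (gradx g a b - gradx g x y) +
        (gradx g x t - gradx g a c)) + (gradx g a c - gradx g a s) := by
    module
  have h1 := norm_gradx_sub_sq_le hf a x b y
  have h2 := norm_gradx_sub_sq_le hg a x b y
  have h3 := norm_gradx_sub_sq_le hg x a t c
  have h4 := norm_gradx_sub_sq_le hg a a c s
  have h5 := norm_add_sq_le_two (μ • (gradx f a b - gradx f x y) + (gradx g a b - gradx g x y) +
        (gradx g x t - gradx g a c)) (gradx g a c - gradx g a s)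
  have h6 := norm_add_sq_le_three (μ • (gradx f a b - gradx f x y)) (gradx g a b - gradx g x y)
        (gradx g x t - gradx g a c)
  rw [norm_smul, mul_pow, Real.norm_eq_abs, sq_abs] at h6
  have h7 := mul_le_mul_of_nonneg_left h1 (sq_nonneg μ)
  rw [norm_sub_rev a x, norm_sub_rev b y] at h2 h7
  rw [sub_self, norm_zero] at h4
  rw [e]
  linarith

/-- Error of the averaged inexact direction in the second block. -/
lemma norm_direction_y_sub_sq_le {L₁ L₂ μ γ : ℝ} {f g : Euc dx → Euc dy → ℝ}
    (hf : LSmooth L₁ f) (hg : LSmooth L₂ g) (a x : Euc dx) (b y c t s : Euc dy) :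
    ‖(μ • grady f a b + grady g a b - γ⁻¹ • (b - s)) -
        (μ • grady f x y + grady g x y - γ⁻¹ • (y - t))‖ ^ 2 ≤
      8 * (μ ^ 2 * L₁ ^ 2 + L₂ ^ 2) * ‖x - a‖ ^ 2 +
        8 * (μ ^ 2 * L₁ ^ 2 + L₂ ^ 2 + 1 / γ ^ 2) * ‖y - b‖ ^ 2 + 8 / γ ^ 2 * ‖t - c‖ ^ 2 +
        2 / γ ^ 2 * ‖c - s‖ ^ 2 := by
  set A := μ • (grady f a b - grady f x y)
  set B := grady g a b - grady g x y
  have e : (μ • grady f a b + grady g a b - γ⁻¹ • (b - s)) -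
        (μ • grady f x y + grady g x y - γ⁻¹ • (y - t)) =
      ((A + B) + (γ⁻¹ • (y - b) + γ⁻¹ • (c - t))) + γ⁻¹ • (s - c) := by
    module
  have h1 := norm_grady_sub_sq_le hf a x b y
  have h2 := norm_grady_sub_sq_le hg a x b y
  have h5 := norm_add_sq_le_two ((A + B) + (γ⁻¹ • (y - b) + γ⁻¹ • (c - t))) (γ⁻¹ • (s - c))
  have h6 := norm_add_sq_le_two (A + B) (γ⁻¹ • (y - b) + γ⁻¹ • (c - t))
  have h7 := norm_add_sq_le_two A B
  have h8 := norm_add_sq_le_two (γ⁻¹ • (y - b)) (γ⁻¹ • (c - t))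
  have hA : ‖A‖ ^ 2 = μ ^ 2 * ‖grady f a b - grady f x y‖ ^ 2 := by
    rw [norm_smul, mul_pow, Real.norm_eq_abs, sq_abs]
  have hs (w : Euc dy) : ‖γ⁻¹ • w‖ ^ 2 = (γ ^ 2)⁻¹ * ‖w‖ ^ 2 := by
    rw [norm_smul, mul_pow, Real.norm_eq_abs, sq_abs, inv_pow]
  have h9 := mul_le_mul_of_nonneg_left h1 (sq_nonneg μ)
  rw [hs, hs, norm_sub_rev c t] at h8
  rw [hs, norm_sub_rev s c] at h5
  rw [norm_sub_rev a x, norm_sub_rev b y] at h2 h9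
  rw [e, div_eq_mul_inv 8, div_eq_mul_inv 2, one_div]
  linarith

/-- Averaging a bound that is affine in the squared consensus errors. -/
lemma norm_avg_sub_avg_sq_le {n d : ℕ} (hn : 0 < n) {p q : Fin n → Euc d}
    {xv : Fin n → Euc dx} {yv θv : Fin n → Euc dy} {A B C T : ℝ}
    (h : ∀ i, ‖p i - q i‖ ^ 2 ≤ A * ‖xv i - avg xv‖ ^ 2 + B * ‖yv i - avg yv‖ ^ 2 +
      C * ‖θv i - avg θv‖ ^ 2 + T) :
    ‖(n : ℝ)⁻¹ • ∑ i, p i - (n : ℝ)⁻¹ • ∑ i, q i‖ ^ 2 ≤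
      A * devSq xv + B * devSq yv + C * devSq θv + T := by
  have hn' : (0 : ℝ) < n := by exact_mod_cast hn
  rw [← smul_sub, ← Finset.sum_sub_distrib]
  refine (norm_avg_sq_le _).trans ?_
  calc (n : ℝ)⁻¹ * ∑ i, ‖p i - q i‖ ^ 2
      ≤ (n : ℝ)⁻¹ * ∑ i, (A * ‖xv i - avg xv‖ ^ 2 + B * ‖yv i - avg yv‖ ^ 2 +
        C * ‖θv i - avg θv‖ ^ 2 + T) := by gcongr with i; exact h i
    _ = _ := by
        simp only [devSq, Finset.sum_add_distrib, ← Finset.mul_sum, Finset.sum_const,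
          Finset.card_univ, Fintype.card_fin, nsmul_eq_mul]
        field_simp

end PenalizedDescent

open PenalizedDescent

/-- one-step descent of the penalized objective
`Φ_μ(x,y) = μ(F(x,y) − F̲) + G(x,y) − V_γ(x,y)` along the exact averaged descent
directions.  Here `F = (1/n)∑ fᵢ`, `G = (1/n)∑ gᵢ`, `θs` is the proximal solution map of
`G` (the unique minimizer characterized by `hθs`), `L_Φ = μL₁ + L₂ + max{L₂, 1/γ}`,
`x̄⁺ = x̄ − λ_x D̄_x`, `ȳ⁺ = ȳ − λ_y D̄_y`, and `Δ_x, Δ_y, Δ_θ` are the consensus errors. -/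
theorem penalized_objective_descent {dx dy n : ℕ} (hn : 0 < n) (L₁ L₂ γ μ Fbar lamx lamy : ℝ)
    (hL₂ : 0 < L₂) (hγ0 : 0 < γ) (hγ : γ < 1 / (2 * L₂)) (hμ : 0 ≤ μ)
    (hlamx : 0 < lamx) (hlamy : 0 < lamy)
    (f g : Fin n → Euc dx → Euc dy → ℝ)
    (hf : ∀ i, LSmooth L₁ (f i)) (hg : ∀ i, LSmooth L₂ (g i))
    (F G : Euc dx → Euc dy → ℝ)
    (hF : F = fun a b => (n : ℝ)⁻¹ * ∑ i, f i a b)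
    (hG : G = fun a b => (n : ℝ)⁻¹ * ∑ i, g i a b)
    (hFb : ∀ x y, Fbar ≤ F x y)
    (θs : Euc dx → Euc dy → Euc dy)
    (hθs : ∀ x y θ, θ ≠ θs x y →
      G x (θs x y) + ‖θs x y - y‖ ^ 2 / (2 * γ) < G x θ + ‖θ - y‖ ^ 2 / (2 * γ))
    (xv : Fin n → Euc dx) (yv θv : Fin n → Euc dy)
    (Dx : Euc dx) (Dy : Euc dy)
    (hDx : Dx = (n : ℝ)⁻¹ • ∑ i, (μ • gradx (f i) (xv i) (yv i) +
      gradx (g i) (xv i) (yv i) - gradx (g i) (xv i) (θv i)))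
    (hDy : Dy = (n : ℝ)⁻¹ • ∑ i, (μ • grady (f i) (xv i) (yv i) +
      grady (g i) (xv i) (yv i) - γ⁻¹ • (yv i - θv i)))
    (xp : Euc dx) (yp : Euc dy)
    (hxp : xp = avg xv - lamx • Dx) (hyp : yp = avg yv - lamy • Dy) :
    (μ * (F xp yp - Fbar) + G xp yp - moreau G γ xp yp) -
        (μ * (F (avg xv) (avg yv) - Fbar) + G (avg xv) (avg yv) -
          moreau G γ (avg xv) (avg yv)) ≤
      -(1 / (2 * lamx) - (μ * L₁ + L₂ + max L₂ (1 / γ)) / 2) * ‖xp - avg xv‖ ^ 2 -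
        (1 / (2 * lamy) - (μ * L₁ + L₂ + max L₂ (1 / γ)) / 2) * ‖yp - avg yv‖ ^ 2 +
        (lamx * L₂ ^ 2 + lamy / γ ^ 2) * ‖avg θv - θs (avg xv) (avg yv)‖ ^ 2 +
        (3 * lamx * (μ ^ 2 * L₁ ^ 2 + 2 * L₂ ^ 2) + 4 * lamy * (μ ^ 2 * L₁ ^ 2 + L₂ ^ 2)) *
          devSq xv +
        (3 * lamx * (μ ^ 2 * L₁ ^ 2 + L₂ ^ 2) +
          4 * lamy * (μ ^ 2 * L₁ ^ 2 + L₂ ^ 2 + 1 / γ ^ 2)) * devSq yv +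
        (3 * lamx * L₂ ^ 2 + 4 * lamy / γ ^ 2) * devSq θv := by
  have hn' : (n : ℝ) ≠ 0 := by exact_mod_cast hn.ne'
  have hθ (x : Euc dx) (y θ : Euc dy) :
      G x (θs x y) + ‖θs x y - y‖ ^ 2 / (2 * γ) ≤ G x θ + ‖θ - y‖ ^ 2 / (2 * γ) := by
    by_cases h : θ = θs x y
    · rw [h]
    · exact (hθs x y θ h).le
  rw [moreau_eq (hθs xp yp), moreau_eq (hθs (avg xv) (avg yv))]
  set a := avg xv
  set b := avg yv
  set s := θs a b
  subst hF hG
  have hFd := (abs_le.1 (abs_avg_taylor_remainder_le hn hf a xp b yp)).2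
  have hGd := (abs_le.1 (abs_avg_taylor_remainder_le hn hg a xp b yp)).2
  have hV := prox_value_sub_ge hn hL₂ hγ0 hγ hg (x' := xp) (y' := yp) (t' := θs xp yp) (hθ a b)
  have hμF := mul_le_mul_of_nonneg_left hFd hμ
  have hx := inner_step_le hlamx ((n : ℝ)⁻¹ • ∑ i, (μ • gradx (f i) a b + gradx (g i) a b -
    gradx (g i) a s)) Dx (xp - a) (by rw [hxp]; abel)
  have hy := inner_step_le hlamy ((n : ℝ)⁻¹ • ∑ i, (μ • grady (f i) a b + grady (g i) a b -
    γ⁻¹ • (b - s))) Dy (yp - b) (by rw [hyp]; abel)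
  have hex := norm_avg_sub_avg_sq_le hn fun i =>
    norm_direction_x_sub_sq_le (μ := μ) (hf i) (hg i) a (xv i) b (yv i) (avg θv) (θv i) s
  have hey := norm_avg_sub_avg_sq_le hn fun i =>
    norm_direction_y_sub_sq_le (μ := μ) (γ := γ) (hf i) (hg i) a (xv i) b (yv i) (avg θv) (θv i) s
  rw [← hDx] at hex
  rw [← hDy] at hey
  have hex' := mul_le_mul_of_nonneg_left hex (half_pos hlamx).le
  have hey' := mul_le_mul_of_nonneg_left hey (half_pos hlamy).le
  have ex : ⟪(n : ℝ)⁻¹ • ∑ i, (μ • gradx (f i) a b + gradx (g i) a b - gradx (g i) a s),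
      xp - a⟫ = μ * ⟪(n : ℝ)⁻¹ • ∑ i, gradx (f i) a b, xp - a⟫ +
        ⟪(n : ℝ)⁻¹ • ∑ i, gradx (g i) a b, xp - a⟫ -
        ⟪(n : ℝ)⁻¹ • ∑ i, gradx (g i) a s, xp - a⟫ := by
    rw [← real_inner_smul_left, ← inner_add_left, ← inner_sub_left]
    simp only [Finset.sum_sub_distrib, Finset.sum_add_distrib, ← Finset.smul_sum]
    congr 1
    module
  have ey : ⟪(n : ℝ)⁻¹ • ∑ i, (μ • grady (f i) a b + grady (g i) a b - γ⁻¹ • (b - s)),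
      yp - b⟫ = μ * ⟪(n : ℝ)⁻¹ • ∑ i, grady (f i) a b, yp - b⟫ +
        ⟪(n : ℝ)⁻¹ • ∑ i, grady (g i) a b, yp - b⟫ - γ⁻¹ * ⟪b - s, yp - b⟫ := by
    rw [← real_inner_smul_left, ← real_inner_smul_left, ← inner_add_left, ← inner_sub_left]
    simp only [Finset.sum_sub_distrib, Finset.sum_add_distrib, ← Finset.smul_sum,
      Finset.sum_const, Finset.card_univ, Fintype.card_fin]
    congr 1
    match_scalars <;> field_simp
  rw [ex] at hx
  rw [ey] at hy
  simp only [div_eq_mul_inv] at *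
  linarith
end
end
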